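/- The function y ↦ z(y) = θ₂(y)⁴ θ₄(y)⁴ / θ₃(y)⁸ is strictly increasing on the interval (0, 1] and strictly decreasing on the interval [1, ∞); in particular y = 1 is its unique maximum point on (0,∞). -/

import Mathlib

/-- Jacobi theta constant θ₂ on the imaginary axis. -/
noncomputable def theta2 (y : ℝ) : ℝ := ∑' n : ℤ, Real.exp (-Real.pi * y * (n + 1/2)^2)

/-- Jacobi theta constant θ₃ on the imaginary axis. -/
noncomputable def theta3 (y : ℝ) : ℝ := ∑' n : ℤ, Real.exp (-Real.pi * y * n^2)

/-- Jacobi theta constant θ₄ on the imaginary axis. -/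
noncomputable def theta4 (y : ℝ) : ℝ := ∑' n : ℤ, (-1 : ℝ)^n * Real.exp (-Real.pi * y * n^2)

/-- The function z(y) = θ₂(y)⁴θ₄(y)⁴/θ₃(y)⁸. -/
noncomputable def zfun (y : ℝ) : ℝ := theta2 y ^ 4 * theta4 y ^ 4 / theta3 y ^ 8

/-- Splitting `ℤ × ℤ` according to the parity of the sum of the coordinates. -/
def parityEquiv : (ℤ × ℤ) ⊕ (ℤ × ℤ) ≃ ℤ × ℤ where
  toFun := Sum.elim (fun p => (p.1 + p.2, p.1 - p.2)) (fun p => (p.1 + p.2 + 1, p.1 - p.2))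
  invFun p := if (p.1 + p.2) % 2 = 0 then Sum.inl ((p.1 + p.2) / 2, (p.1 - p.2) / 2)
    else Sum.inr ((p.1 + p.2) / 2, (p.1 - p.2) / 2)
  left_inv := by
    rintro (⟨a, b⟩ | ⟨a, b⟩)
    · have h : (a + b + (a - b)) % 2 = 0 := by lia
      simp only [Sum.elim_inl, h, if_true, Sum.inl.injEq, Prod.mk.injEq]
      lia
    · have h : ¬ (a + b + 1 + (a - b)) % 2 = 0 := by lia
      simp only [Sum.elim_inr, h, if_false, Sum.inr.injEq, Prod.mk.injEq]
      lia
  right_inv := by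
    rintro ⟨m, n⟩
    by_cases h : (m + n) % 2 = 0
    · simp only [h, if_true, Sum.elim_inl, Prod.mk.injEq]
      lia
    · simp only [h, if_false, Sum.elim_inr, Prod.mk.injEq]
      lia

/-- The product of two absolutely convergent series over `ℤ`, rearranged by parity. -/
lemma tsum_mul_tsum_parity {f g : ℤ → ℝ} (hf : Summable fun n => ‖f n‖)
    (hg : Summable fun n => ‖g n‖) :
    (∑' n, f n) * ∑' n, g n = ∑' p : ℤ × ℤ, f (p.1 + p.2) * g (p.1 - p.2) +
      ∑' p : ℤ × ℤ, f (p.1 + p.2 + 1) * g (p.1 - p.2) := by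
  have hs := summable_mul_of_summable_norm hf hg
  have hs' := parityEquiv.summable_iff.mpr hs
  rw [tsum_mul_tsum_of_summable_norm hf hg, ← parityEquiv.tsum_eq,
    Summable.tsum_sum (f := fun x => f (parityEquiv x).1 * g (parityEquiv x).2)]
  · rfl
  · exact hs'.comp_injective Sum.inl_injective
  · exact hs'.comp_injective Sum.inr_injective

lemma hasSum_theta2 {y : ℝ} (hy : 0 < y) :
    HasSum (fun n : ℤ => Real.exp (-Real.pi * y * (n + 1/2)^2)) (theta2 y) := by
  refine Summable.hasSum ?_
  refine (HurwitzZeta.hasSum_int_evenKernel (1/2) hy).summable.congr fun n => ?_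
  congr 1; ring

lemma hasSum_theta3 {y : ℝ} (hy : 0 < y) :
    HasSum (fun n : ℤ => Real.exp (-Real.pi * y * n^2)) (theta3 y) := by
  refine Summable.hasSum ?_
  refine (HurwitzZeta.hasSum_int_evenKernel 0 hy).summable.congr fun n => ?_
  congr 1; ring

lemma norm_theta4_term (y : ℝ) (n : ℤ) :
    ‖(-1 : ℝ)^n * Real.exp (-Real.pi * y * n^2)‖ = Real.exp (-Real.pi * y * n^2) := by
  simp

lemma theta2_sq {y : ℝ} (hy : 0 < y) : theta2 y ^ 2 = 2 * theta2 (2 * y) * theta3 (2 * y) := by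
  have h2 : 0 < 2 * y := by positivity
  have hs := (hasSum_theta2 hy).summable.norm
  have hs2 := (hasSum_theta2 h2).summable.norm
  have hs3 := (hasSum_theta3 h2).summable.norm
  have e1 : theta2 (2 * y) * theta3 (2 * y) = ∑' p : ℤ × ℤ,
      Real.exp (-Real.pi * y * ((p.1 + p.2 : ℤ) + 1/2)^2) *
        Real.exp (-Real.pi * y * ((p.1 - p.2 : ℤ) + 1/2)^2) := by
    rw [theta2, theta3, tsum_mul_tsum_of_summable_norm hs2 hs3]
    refine tsum_congr fun p => ?_
    rw [← Real.exp_add, ← Real.exp_add]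
    congr 1; push_cast; ring
  have e2 : theta3 (2 * y) * theta2 (2 * y) = ∑' p : ℤ × ℤ,
      Real.exp (-Real.pi * y * ((p.1 + p.2 + 1 : ℤ) + 1/2)^2) *
        Real.exp (-Real.pi * y * ((p.1 - p.2 : ℤ) + 1/2)^2) := by
    rw [theta2, theta3, tsum_mul_tsum_of_summable_norm hs3 hs2,
      ← ((Equiv.addRight (1 : ℤ)).prodCongr (Equiv.refl ℤ)).tsum_eq]
    refine tsum_congr fun p => ?_
    rw [← Real.exp_add, ← Real.exp_add]
    simp only [Equiv.prodCongr_apply, Prod.map_fst, Prod.map_snd, Equiv.coe_addRight,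
      Equiv.refl_apply]
    congr 1; push_cast; ring
  have key := tsum_mul_tsum_parity hs hs
  rw [← e1, ← e2] at key
  rw [sq]
  exact key.trans (by ring)

lemma theta3_sq {y : ℝ} (hy : 0 < y) :
    theta3 y ^ 2 = theta3 (2 * y) ^ 2 + theta2 (2 * y) ^ 2 := by
  have h2 : 0 < 2 * y := by positivity
  have hs := (hasSum_theta3 hy).summable.norm
  have hs2 := (hasSum_theta2 h2).summable.norm
  have hs3 := (hasSum_theta3 h2).summable.norm
  simp only [sq (theta3 _), sq (theta2 _)]
  refine (tsum_mul_tsum_parity hs hs).trans ?_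
  rw [theta2, theta3, tsum_mul_tsum_of_summable_norm hs3 hs3,
    tsum_mul_tsum_of_summable_norm hs2 hs2]
  congr 1 <;> refine tsum_congr fun p => ?_ <;> rw [← Real.exp_add, ← Real.exp_add] <;>
    congr 1 <;> push_cast <;> ring

lemma theta4_sq {y : ℝ} (hy : 0 < y) :
    theta4 y ^ 2 = theta3 (2 * y) ^ 2 - theta2 (2 * y) ^ 2 := by
  have h2 : 0 < 2 * y := by positivity
  have hs : Summable fun n : ℤ => ‖(-1 : ℝ)^n * Real.exp (-Real.pi * y * n^2)‖ :=
    (hasSum_theta3 hy).summable.congr fun n => (norm_theta4_term y n).symm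
  have hs2 := (hasSum_theta2 h2).summable.norm
  have hs3 := (hasSum_theta3 h2).summable.norm
  simp only [sq (theta3 _), sq (theta2 _), sq (theta4 _)]
  refine (tsum_mul_tsum_parity hs hs).trans ?_
  rw [theta2, theta3, tsum_mul_tsum_of_summable_norm hs3 hs3,
    tsum_mul_tsum_of_summable_norm hs2 hs2, sub_eq_add_neg, ← tsum_neg]
  congr 1 <;> refine tsum_congr fun p => ?_ <;>
    rw [mul_mul_mul_comm, ← zpow_add₀ (by norm_num), ← Real.exp_add, ← Real.exp_add]
  · rw [Even.neg_one_zpow ⟨p.1, by ring⟩, one_mul]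
    congr 1; push_cast; ring
  · rw [Odd.neg_one_zpow ⟨p.1, by ring⟩, neg_one_mul]
    congr 2; push_cast; ring

/-- Jacobi's quartic identity. -/
lemma jacobi_quartic {y : ℝ} (hy : 0 < y) : theta2 y ^ 4 + theta4 y ^ 4 = theta3 y ^ 4 := by
  have e (x : ℝ) : x ^ 4 = (x ^ 2) ^ 2 := by ring
  rw [e, e, e (theta3 y), theta2_sq hy, theta3_sq hy, theta4_sq hy]
  ring

lemma theta2_one_eq_theta4_one : theta2 1 = theta4 1 := by
  have h2 := HurwitzZeta.hasSum_int_evenKernel (1/2) one_pos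
  have h4 := HurwitzZeta.hasSum_int_cosKernel (1/2) one_pos
  have h := HurwitzZeta.evenKernel_functional_equation ((1/2 : ℝ) : UnitAddCircle) 1
  have e2 : theta2 1 = HurwitzZeta.evenKernel ((1/2 : ℝ) : UnitAddCircle) 1 := by
    rw [← h2.tsum_eq, theta2]
    exact tsum_congr fun n => by congr 1; ring
  have e4 : theta4 1 = HurwitzZeta.cosKernel ((1/2 : ℝ) : UnitAddCircle) 1 := by
    rw [← Complex.ofReal_inj, ← h4.tsum_eq, theta4, Complex.ofReal_tsum]
    refine tsum_congr fun n => ?_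
    have : Complex.exp (2 * Real.pi * Complex.I * ((1/2 : ℝ) : ℂ) * n) = (-1) ^ n := by
      rw [← Complex.exp_pi_mul_I, ← Complex.exp_int_mul]
      congr 1; push_cast; ring
    rw [this]
    push_cast
    congr 2; ring
  rw [e2, e4, h]
  simp

lemma theta2_pos {y : ℝ} (hy : 0 < y) : 0 < theta2 y :=
  (hasSum_theta2 hy).summable.tsum_pos (fun _ => (Real.exp_pos _).le) 0 (Real.exp_pos _)

lemma theta3_pos {y : ℝ} (hy : 0 < y) : 0 < theta3 y :=
  (hasSum_theta3 hy).summable.tsum_pos (fun _ => (Real.exp_pos _).le) 0 (Real.exp_pos _)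

lemma theta2_le_theta3 {y : ℝ} (hy : 0 < y) : theta2 y ≤ theta3 y := by
  have h := theta4_sq (half_pos hy)
  rw [mul_div_cancel₀ y two_ne_zero] at h
  exact le_of_sq_le_sq (by nlinarith [sq_nonneg (theta4 (y / 2))]) (theta3_pos hy).le

lemma one_le_theta3 {y : ℝ} (hy : 0 < y) : 1 ≤ theta3 y := by
  have h := le_hasSum (hasSum_theta3 hy) 0 fun _ _ => (Real.exp_pos _).le
  simpa using h

lemma exp_le_theta2 {y : ℝ} (hy : 0 < y) : Real.exp (-(Real.pi * y / 4)) ≤ theta2 y := by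
  have h := le_hasSum (hasSum_theta2 hy) 0 fun _ _ => (Real.exp_pos _).le
  refine le_trans (Real.exp_le_exp.2 (le_of_eq ?_)) h
  push_cast; ring

lemma theta3_anti {x y : ℝ} (hx : 0 < x) (hxy : x ≤ y) : theta3 y ≤ theta3 x := by
  refine hasSum_le (fun n => ?_) (hasSum_theta3 (hx.trans_le hxy)) (hasSum_theta3 hx)
  have : 0 ≤ Real.pi * (y - x) * (n : ℝ)^2 :=
    mul_nonneg (mul_nonneg Real.pi_pos.le (sub_nonneg.2 hxy)) (sq_nonneg _)
  exact Real.exp_le_exp.2 (by linarith)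

lemma theta2_le_exp_mul {x y : ℝ} (hx : 0 < x) (hxy : x ≤ y) :
    theta2 y ≤ Real.exp (-(Real.pi * (y - x) / 4)) * theta2 x := by
  refine hasSum_le (fun n => ?_) (hasSum_theta2 (hx.trans_le hxy)) ((hasSum_theta2 hx).mul_left _)
  rw [← Real.exp_add]
  have hn : (0 : ℝ) ≤ (n + 1/2)^2 - 1/4 := by
    have : (0 : ℤ) ≤ n * (n + 1) := by
      rcases le_or_gt 0 n with h | h
      · positivity
      · exact mul_nonneg_of_nonpos_of_nonpos h.le (by lia)
    have : (0 : ℝ) ≤ n * (n + 1) := by exact_mod_cast this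
    linarith
  have := mul_nonneg (mul_nonneg Real.pi_pos.le (sub_nonneg.2 hxy)) hn
  exact Real.exp_le_exp.2 (by linarith)

/-- The ratio `θ₂ / θ₃`, the square root of the elliptic modulus. -/
noncomputable def thetaRatio (y : ℝ) : ℝ := theta2 y / theta3 y

lemma thetaRatio_pos {y : ℝ} (hy : 0 < y) : 0 < thetaRatio y :=
  div_pos (theta2_pos hy) (theta3_pos hy)

lemma thetaRatio_le_one {y : ℝ} (hy : 0 < y) : thetaRatio y ≤ 1 :=
  (div_le_one (theta3_pos hy)).2 (theta2_le_theta3 hy)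

/-- Landen's transformation. -/
lemma thetaRatio_sq {y : ℝ} (hy : 0 < y) :
    thetaRatio y ^ 2 = 2 * thetaRatio (2 * y) / (1 + thetaRatio (2 * y) ^ 2) := by
  have h3 := theta3_pos (y := 2 * y) (by positivity)
  rw [thetaRatio, thetaRatio, div_pow, theta2_sq hy, theta3_sq hy]
  field_simp

lemma thetaRatio_lt_of_double {x y : ℝ} (hx : 0 < x) (hy : 0 < y)
    (h : thetaRatio (2 * y) < thetaRatio (2 * x)) : thetaRatio y < thetaRatio x := by
  refine lt_of_pow_lt_pow_left₀ 2 (thetaRatio_pos hx).le ?_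
  rw [thetaRatio_sq hx, thetaRatio_sq hy, div_lt_div_iff₀ (by positivity) (by positivity)]
  have h0 := thetaRatio_pos (y := 2 * y) (by positivity)
  have h1 := thetaRatio_le_one (y := 2 * x) (by positivity)
  have : thetaRatio (2 * y) * thetaRatio (2 * x) < 1 := by nlinarith
  nlinarith [mul_pos (sub_pos.2 h) (sub_pos.2 this)]

lemma thetaRatio_lt_of_pow_mul {x y : ℝ} (hx : 0 < x) (hy : 0 < y) (n : ℕ)
    (h : thetaRatio (2 ^ n * y) < thetaRatio (2 ^ n * x)) : thetaRatio y < thetaRatio x := by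
  induction n with
  | zero => simpa using h
  | succ n ih =>
    refine ih (thetaRatio_lt_of_double (by positivity) (by positivity) ?_)
    rwa [← mul_assoc, ← mul_assoc, ← pow_succ']

lemma exists_thetaRatio_pow_mul_lt {x y : ℝ} (hx : 0 < x) (hxy : x < y) :
    ∃ n : ℕ, thetaRatio (2 ^ n * y) < thetaRatio (2 ^ n * x) := by
  have hy := hx.trans hxy
  set C := Real.exp (Real.pi * y / 4) * theta2 y * theta3 x
  have hc : 0 < Real.pi * (y - x) / 4 := by
    have := Real.pi_pos
    have := sub_pos.2 hxy
    positivity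
  have hlim : Filter.Tendsto (fun n : ℕ => Real.exp (2 ^ n * (Real.pi * (y - x) / 4)))
      Filter.atTop Filter.atTop :=
    Real.tendsto_exp_atTop.comp
      ((tendsto_pow_atTop_atTop_of_one_lt one_lt_two).atTop_mul_const hc)
  obtain ⟨n, hn⟩ := (hlim.eventually_gt_atTop C).exists
  refine ⟨n, ?_⟩
  have h1 : (1 : ℝ) ≤ 2 ^ n := one_le_pow₀ one_le_two
  have hX : 0 < 2 ^ n * x := by positivity
  have hY : 0 < 2 ^ n * y := by positivity
  calc thetaRatio (2 ^ n * y) ≤ theta2 (2 ^ n * y) :=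
        div_le_self (theta2_pos hY).le (one_le_theta3 hY)
    _ ≤ Real.exp (-(Real.pi * (2 ^ n * y - y) / 4)) * theta2 y :=
        theta2_le_exp_mul hy (le_mul_of_one_le_left hy.le h1)
    _ < Real.exp (-(Real.pi * (2 ^ n * x) / 4)) / theta3 x := by
        rw [lt_div_iff₀ (theta3_pos hx)]
        have e1 : Real.exp (-(Real.pi * (2 ^ n * y - y) / 4)) * theta2 y * theta3 x =
            Real.exp (-(Real.pi * (2 ^ n * y) / 4)) * C := by
          rw [show -(Real.pi * (2 ^ n * y - y) / 4) =
            -(Real.pi * (2 ^ n * y) / 4) + Real.pi * y / 4 by ring, Real.exp_add]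
          simp only [C]; ring
        have e2 : Real.exp (-(Real.pi * (2 ^ n * x) / 4)) =
            Real.exp (-(Real.pi * (2 ^ n * y) / 4)) *
              Real.exp (2 ^ n * (Real.pi * (y - x) / 4)) := by
          rw [← Real.exp_add]; congr 1; ring
        rw [e1, e2]
        exact mul_lt_mul_of_pos_left hn (Real.exp_pos _)
    _ ≤ thetaRatio (2 ^ n * x) :=
        div_le_div₀ (theta2_pos hX).le (exp_le_theta2 hX) (theta3_pos hX)
          (theta3_anti hx (le_mul_of_one_le_left hx.le h1))

lemma thetaRatio_strictAntiOn : StrictAntiOn thetaRatio (Set.Ioi 0) := by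
  intro x hx y hy hxy
  obtain ⟨n, hn⟩ := exists_thetaRatio_pow_mul_lt hx hxy
  exact thetaRatio_lt_of_pow_mul hx hy n hn

lemma thetaRatio_pow_four_strictAntiOn :
    StrictAntiOn (fun y => thetaRatio y ^ 4) (Set.Ioi 0) := fun _ hx _ hy hxy =>
  pow_lt_pow_left₀ (thetaRatio_strictAntiOn hx hy hxy) (thetaRatio_pos hy).le four_ne_zero

lemma zfun_eq {y : ℝ} (hy : 0 < y) : zfun y = thetaRatio y ^ 4 * (1 - thetaRatio y ^ 4) := by
  have h3 := theta3_pos hy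
  rw [zfun, thetaRatio, eq_sub_of_add_eq' (jacobi_quartic hy)]
  field_simp

lemma thetaRatio_one_pow_four : thetaRatio 1 ^ 4 = 1 / 2 := by
  have h3 := theta3_pos one_pos
  have h := jacobi_quartic one_pos
  rw [← theta2_one_eq_theta4_one] at h
  rw [thetaRatio, div_pow, div_eq_iff (by positivity)]
  linarith

theorem zfun_strictMono_strictAnti :
    StrictMonoOn zfun (Set.Ioc (0 : ℝ) 1) ∧ StrictAntiOn zfun (Set.Ici (1 : ℝ)) ∧
      ∀ y : ℝ, 0 < y → y ≠ 1 → zfun y < zfun 1 := by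
  have hanti := thetaRatio_pow_four_strictAntiOn
  have hone := thetaRatio_one_pow_four
  have hmono : StrictMonoOn zfun (Set.Ioc (0 : ℝ) 1) := by
    intro x hx y hy hxy
    have h1 := hanti hx.1 hy.1 hxy
    have h2 := hanti.antitoneOn hy.1 (Set.mem_Ioi.2 one_pos) hy.2
    simp only [hone] at h1 h2
    rw [zfun_eq hx.1, zfun_eq hy.1]
    nlinarith
  have hdecr : StrictAntiOn zfun (Set.Ici (1 : ℝ)) := by
    intro x hx y hy hxy
    have hx0 : 0 < x := one_pos.trans_le hx
    have hy0 : 0 < y := one_pos.trans_le hy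
    have h1 := hanti hx0 hy0 hxy
    have h2 := hanti.antitoneOn (Set.mem_Ioi.2 one_pos) hx0 hx
    simp only [hone] at h1 h2
    rw [zfun_eq hx0, zfun_eq hy0]
    nlinarith
  refine ⟨hmono, hdecr, fun y hy hne => ?_⟩
  rcases lt_or_gt_of_ne hne with h | h
  · exact hmono ⟨hy, h.le⟩ ⟨one_pos, le_rfl⟩ h
  · exact hdecr Set.self_mem_Ici h.le h
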